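/- arXiv:1111.6291 — 2 statements merged into one kernel-verified Lean document; each statement's English description precedes it below -/
import Mathlib

section
/- Distinct log-concave projections under multiplicative scaling (Lemma A.5). Let X_u, X_l, Y be real random variables and let R_u, R_l, Q be the distributions of X_u Y, X_l Y and Y respectively. Assume: (i) X_u and Y are independent with E|X_u| < ∞; (ii) X_l and Y are independent; (iii) Q ∈ 𝒬*; (iv) there exists m > 0 such that P(X_u > m) = 1 and P(0 < X_l ≤ m) = 1. Then ψ(·|R_u) ≠ ψ(·|R_l), i.e. the log-concave projections of R_u and R_l differ. -/
open MeasureTheory ProbabilityTheory Filter Topology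
open scoped ENNReal NNReal

noncomputable section

/-- The exponential map `EReal → ℝ≥0∞` (sends `⊥` to `0` and `⊤` to `∞`). -/
def expEReal (x : EReal) : ℝ≥0∞ :=
  if x = ⊥ then 0 else if x = ⊤ then ⊤ else ENNReal.ofReal (Real.exp x.toReal)

/-- Real-valued exponential of an extended real (sends `⊥` to `0`). -/
def expE (x : EReal) : ℝ := (expEReal x).toReal

/-- Extended-real logarithm of a real number (`⊥` for nonpositive input). -/
def elog (r : ℝ) : EReal := if r ≤ 0 then (⊥ : EReal) else ((Real.log r : ℝ) : EReal)

/-- Concavity for `EReal`-valued functions on `ℝ`. -/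
def ErealConcaveOn (φ : ℝ → EReal) : Prop :=
  ∀ x y t : ℝ, 0 ≤ t → t ≤ 1 →
    (t : EReal) * φ x + ((1 - t : ℝ) : EReal) * φ y ≤ φ (t * x + (1 - t) * y)

/-- The class `Φ` of concave, upper semicontinuous, coercive functions `ℝ → [-∞, ∞)`. -/
def MemPhi (φ : ℝ → EReal) : Prop :=
  (∀ x, φ x ≠ ⊤) ∧ ErealConcaveOn φ ∧ UpperSemicontinuous φ ∧
    Tendsto φ (cocompact ℝ) (𝓝 ⊥)

/-- Positive part of an extended real, valued in `ℝ≥0∞`. -/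
def erealPosPart (x : EReal) : ℝ≥0∞ := if x = ⊤ then ⊤ else ENNReal.ofReal x.toReal

/-- Integral of an `EReal`-valued function against a measure on `ℝ`. -/
def integralEReal (Q : Measure ℝ) (φ : ℝ → EReal) : EReal :=
  ((∫⁻ x, erealPosPart (φ x) ∂Q : ℝ≥0∞) : EReal)
    - ((∫⁻ x, erealPosPart (-(φ x)) ∂Q : ℝ≥0∞) : EReal)

/-- `𝒬*`: probability distributions on `ℝ` with finite first moment and nonzero variance. -/
def MemQstar (Q : Measure ℝ) : Prop :=
  IsProbabilityMeasure Q ∧ Integrable (fun x : ℝ => x) Q ∧ ¬ ∃ c : ℝ, Q = Measure.dirac c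

open Classical in
/-- The profile log-likelihood functional `L`. -/
def Lfunc (Q : Measure ℝ) : EReal :=
  if ¬ Integrable (fun x : ℝ => x) Q then ⊥
  else if ∃ c : ℝ, Q = Measure.dirac c then ⊤
  else sSup {r : EReal | ∃ φ, MemPhi φ ∧
    r = integralEReal Q φ - ((∫⁻ x, expEReal (φ x) : ℝ≥0∞) : EReal) + 1}

/-- `ψ` is the log-concave projection of `Q`: a maximizer over `Φ` of
`φ ↦ ∫ φ dQ − ∫ e^φ dx + 1`. -/
def IsLogConcaveProj (Q : Measure ℝ) (ψ : ℝ → EReal) : Prop :=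
  MemPhi ψ ∧ ∀ φ, MemPhi φ →
    integralEReal Q φ - ((∫⁻ x, expEReal (φ x) : ℝ≥0∞) : EReal) + 1 ≤
      integralEReal Q ψ - ((∫⁻ x, expEReal (ψ x) : ℝ≥0∞) : EReal) + 1

/-- A nonnegative function on `ℝ` is log-concave. -/
def IsLogConcaveFn (f : ℝ → ℝ) : Prop :=
  (∀ x, 0 ≤ f x) ∧ ∀ x y t : ℝ, 0 ≤ t → t ≤ 1 →
    f x ^ t * f y ^ (1 - t) ≤ f (t * x + (1 - t) * y)

/-- A log-concave probability density on `ℝ`. -/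
def IsLogConcaveDensity (f : ℝ → ℝ) : Prop :=
  IsLogConcaveFn f ∧ (∫ x, f x) = 1

/-- `f` is the best log-concave approximation `f₀*` of `Q`. -/
def IsBestLogConcaveApprox (Q : Measure ℝ) (f : ℝ → ℝ) : Prop :=
  IsLogConcaveDensity f ∧ ∀ g, IsLogConcaveDensity g →
    integralEReal Q (fun x => elog (g x)) ≤ integralEReal Q (fun x => elog (f x))

/-- The first Mallows (Wasserstein-1) distance between two measures on `ℝ`. -/
def mallows1 (μ ν : Measure ℝ) : ℝ≥0∞ :=
  ⨅ (γ : Measure (ℝ × ℝ)) (_ : γ.map Prod.fst = μ) (_ : γ.map Prod.snd = ν),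
    ∫⁻ p, ENNReal.ofReal |p.1 - p.2| ∂γ

/-- A family of random variables is i.i.d. with common distribution `Q`. -/
def IsIID {Ω : Type*} [MeasurableSpace Ω] (μ : Measure Ω) {ι : Type*}
    (ε : ι → Ω → ℝ) (Q : Measure ℝ) : Prop :=
  iIndepFun ε μ ∧ ∀ i, μ.map (ε i) = Q

/-- ARMA polynomial `A_θ(z) = 1 - ∑ aᵢ zⁱ`. -/
def armaA {p : ℕ} (a : Fin p → ℝ) (z : ℂ) : ℂ := 1 - ∑ i : Fin p, (a i : ℂ) * z ^ ((i : ℕ) + 1)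

/-- ARMA polynomial `B_θ(z) = 1 + ∑ bᵢ zⁱ`. -/
def armaB {q : ℕ} (b : Fin q → ℝ) (z : ℂ) : ℂ := 1 + ∑ i : Fin q, (b i : ℂ) * z ^ ((i : ℕ) + 1)

/-- GARCH polynomial `𝒜_θ(z) = ∑ αᵢ zⁱ`. -/
def garchA {r : ℕ} (α : Fin r → ℝ) (z : ℂ) : ℂ := ∑ i : Fin r, (α i : ℂ) * z ^ ((i : ℕ) + 1)

/-- GARCH polynomial `ℬ_θ(z) = 1 - ∑ βᵢ zⁱ`. -/
def garchB {s : ℕ} (β : Fin s → ℝ) (z : ℂ) : ℂ := 1 - ∑ i : Fin s, (β i : ℂ) * z ^ ((i : ℕ) + 1)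

/-- The last coefficient of a coefficient vector (`0` if the vector is empty). -/
def lastC {k : ℕ} (v : Fin k → ℝ) : ℝ := if h : 0 < k then v ⟨k - 1, Nat.sub_lt h one_pos⟩ else 0

/-- The ARMA log-concave objective
`Λ_n(φ, θ) = (1/n) ∑ φ(ε̃ₜ(θ)) − ∫ e^φ + 1`, as a function of `φ` and the residuals. -/
def armaLam (n : ℕ) (φ : ℝ → EReal) (res : ℤ → ℝ) : EReal :=
  ((1 / (n : ℝ) : ℝ) : EReal) * ∑ t ∈ Finset.Icc 1 n, φ (res (t : ℤ))
    - ((∫⁻ x, expEReal (φ x) : ℝ≥0∞) : EReal) + 1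

/-- The ARMA-GARCH log-concave objective
`Λ_n(φ, θ) = (1/n) ∑ φ(η̃ₜ/σ̃ₜ) − (1/2n) ∑ log σ̃ₜ² − ∫ e^φ + 1`. -/
def garchLam (n : ℕ) (φ : ℝ → EReal) (eta sig2 : ℤ → ℝ) : EReal :=
  ((1 / (n : ℝ) : ℝ) : EReal) * ∑ t ∈ Finset.Icc 1 n, φ (eta (t : ℤ) / Real.sqrt (sig2 (t : ℤ)))
    - (((1 / (2 * (n : ℝ))) * ∑ t ∈ Finset.Icc 1 n, Real.log (sig2 (t : ℤ)) : ℝ) : EReal)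
    - ((∫⁻ x, expEReal (φ x) : ℝ≥0∞) : EReal) + 1

end


theorem lc_conc_fwd {ψ : ℝ → EReal} (h : MemPhi ψ) {x y t : ℝ} (ht0 : 0 ≤ t) (ht1 : t ≤ 1)
    (hx : ψ x ≠ ⊥) (hy : ψ y ≠ ⊥) :
    ψ (t * x + (1 - t) * y) ≠ ⊥ ∧
      t * (ψ x).toReal + (1 - t) * (ψ y).toReal ≤ (ψ (t * x + (1 - t) * y)).toReal := by
  obtain ⟨htop, hc, -, -⟩ := h
  have h1 := hc x y t ht0 ht1
  rw [← EReal.coe_toReal (htop x) hx, ← EReal.coe_toReal (htop y) hy, ← EReal.coe_mul,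
    ← EReal.coe_mul, ← EReal.coe_add] at h1
  have h2 : ψ (t * x + (1 - t) * y) ≠ ⊥ := by
    intro h3
    rw [h3] at h1
    exact EReal.coe_ne_bot _ (le_bot_iff.mp h1)
  refine ⟨h2, ?_⟩
  rw [← EReal.coe_toReal (htop _) h2] at h1
  exact_mod_cast h1

theorem lc_conc_bwd {φ : ℝ → EReal} (htop : ∀ x, φ x ≠ ⊤)
    (h : ∀ x y t : ℝ, 0 < t → t < 1 → φ x ≠ ⊥ → φ y ≠ ⊥ → φ (t * x + (1 - t) * y) ≠ ⊥ ∧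
      t * (φ x).toReal + (1 - t) * (φ y).toReal ≤ (φ (t * x + (1 - t) * y)).toReal) :
    ErealConcaveOn φ := by
  intro x y t ht0 ht1
  rcases ht0.eq_or_lt with rfl | ht0
  · simp
  rcases ht1.eq_or_lt with rfl | ht1
  · simp
  by_cases hx : φ x = ⊥
  · rw [hx, EReal.coe_mul_bot_of_pos ht0]; simp
  by_cases hy : φ y = ⊥
  · rw [hy, EReal.coe_mul_bot_of_pos (by linarith)]; simp
  obtain ⟨h1, h2⟩ := h x y t ht0 ht1 hx hy
  rw [← EReal.coe_toReal (htop x) hx, ← EReal.coe_toReal (htop y) hy,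
    ← EReal.coe_toReal (htop _) h1, ← EReal.coe_mul, ← EReal.coe_mul, ← EReal.coe_add]
  exact_mod_cast h2

theorem lc_coercive {φ : ℝ → EReal} (A ε : ℝ) (hε : 0 < ε)
    (h : ∀ x, φ x ≤ ((A - ε * |x| : ℝ) : EReal)) : Tendsto φ (cocompact ℝ) (𝓝 ⊥) := by
  have h1 : Tendsto (fun x : ℝ => ((A - ε * |x| : ℝ) : EReal)) (cocompact ℝ) (𝓝 ⊥) := by
    apply EReal.tendsto_coe_nhds_bot_iff.mpr
    have h2 : Tendsto (fun x : ℝ => |x|) (cocompact ℝ) atTop := tendsto_norm_cocompact_atTop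
    have h3 := (h2.const_mul_atTop hε)
    simpa [sub_eq_add_neg] using tendsto_atBot_add_const_left _ A (tendsto_neg_atTop_atBot.comp h3)
  exact tendsto_of_tendsto_of_tendsto_of_le_of_le tendsto_const_nhds h1 (fun _ => bot_le) h

theorem lc_bound {ψ : ℝ → EReal} (h : MemPhi ψ) :
    ∃ B b : ℝ, 0 < b ∧ ∀ x, ψ x ≤ ((B - b * |x| : ℝ) : EReal) := by
  by_cases hne : ∃ x0, ψ x0 ≠ ⊥
  swap
  · push Not at hne
    exact ⟨0, 1, one_pos, fun x => by rw [hne x]; exact bot_le⟩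
  obtain ⟨x0, hx0⟩ := hne
  have hh := h
  obtain ⟨htop, hc, husc, hco⟩ := h
  set f0 := (ψ x0).toReal with hf0
  have hev : ∀ᶠ x in cocompact ℝ, ψ x < ((f0 - 1 : ℝ) : EReal) :=
    hco.eventually (gt_mem_nhds (EReal.bot_lt_coe _))
  obtain ⟨K, hK, hKs⟩ := mem_cocompact.mp hev
  obtain ⟨r, hr⟩ := hK.isBounded.subset_closedBall x0
  set D := max r 0 + 1 with hD
  have hDpos : 0 < D := by positivity
  have hfar : ∀ x, D ≤ |x - x0| → ψ x < ((f0 - 1 : ℝ) : EReal) := by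
    intro x hx
    apply hKs
    intro hxK
    have := hr hxK
    rw [Metric.mem_closedBall, Real.dist_eq] at this
    have := le_max_left r 0
    linarith
  -- bounded on the ball
  obtain ⟨xm, -, hxm⟩ := UpperSemicontinuousOn.exists_isMaxOn (f := ψ)
    (s := Metric.closedBall x0 D) ⟨x0, by simp [hDpos.le]⟩ (isCompact_closedBall x0 D)
    (husc.upperSemicontinuousOn _)
  set M := (ψ xm).toReal with hM
  have hMle : ψ xm ≤ (M : EReal) := EReal.le_coe_toReal (htop xm)
  refine ⟨max M f0 + 1 + |x0| / D, 1 / D, by positivity, fun x => ?_⟩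
  have habs : |x| ≤ |x - x0| + |x0| := by
    have := abs_add_le (x - x0) x0
    simpa using this
  by_cases hx : |x - x0| ≤ D
  · have h1 : ψ x ≤ ψ xm := hxm (by rw [Metric.mem_closedBall, Real.dist_eq]; exact hx)
    refine h1.trans (hMle.trans ?_)
    have : 1 / D * |x| ≤ 1 + |x0| / D := by
      calc 1 / D * |x| ≤ 1 / D * (D + |x0|) := by gcongr; linarith
        _ = 1 + |x0| / D := by field_simp
    have := le_max_left M f0
    exact_mod_cast (by linarith)
  · push Not at hx
    by_cases hbot : ψ x = ⊥
    · rw [hbot]; exact bot_le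
    have hd : 0 < |x - x0| := by linarith
    set t := D / |x - x0| with ht
    have ht0 : 0 < t := by positivity
    have ht1 : t ≤ 1 := by rw [ht, div_le_one hd]; exact hx.le
    obtain ⟨h1, h2⟩ := lc_conc_fwd hh ht0.le ht1 hbot hx0
    have h3 := hfar (t * x + (1 - t) * x0) (by
      have : t * x + (1 - t) * x0 - x0 = t * (x - x0) := by ring
      rw [this, abs_mul, abs_of_pos ht0, ht]
      field_simp
      rfl)
    rw [← EReal.coe_toReal (htop _) h1] at h3
    have h3' : (ψ (t * x + (1 - t) * x0)).toReal < f0 - 1 := by exact_mod_cast h3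
    have h4 : t * ((ψ x).toReal - f0) ≤ -1 := by nlinarith
    have h5 : (ψ x).toReal - f0 ≤ - (|x - x0| / D) := by
      have : t * (|x - x0| / D) = 1 := by rw [ht]; field_simp
      by_contra hcon
      push Not at hcon
      nlinarith
    rw [← EReal.coe_toReal (htop _) hbot]
    have h6 : 1 / D * |x| ≤ |x - x0| / D + |x0| / D := by
      rw [← add_div, one_div, inv_mul_eq_div]
      gcongr
    have := le_max_right M f0
    exact_mod_cast (by linarith)

theorem lc_pert {ψ : ℝ → EReal} (h : MemPhi ψ) {B b : ℝ}
    (hB : ∀ x, ψ x ≤ ((B - b * |x| : ℝ) : EReal)) {s c d : ℝ} (hs : 0 < s) (hc : |c| < s * b) :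
    MemPhi (fun x => ψ (s * x) + ((c * x + d : ℝ) : EReal)) := by
  have hh := h
  obtain ⟨htop, hconc, husc, hco⟩ := h
  have htop' : ∀ x, ψ (s * x) + ((c * x + d : ℝ) : EReal) ≠ ⊤ := fun x =>
    (EReal.add_lt_top (htop _) (EReal.coe_ne_top _)).ne
  have key : ∀ x, ψ (s * x) + ((c * x + d : ℝ) : EReal) ≠ ⊥ → ψ (s * x) ≠ ⊥ := by
    intro x hx h0
    apply hx
    rw [h0]; simp
  have key2 : ∀ x, ψ (s * x) ≠ ⊥ → ψ (s * x) + ((c * x + d : ℝ) : EReal) =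
      (((ψ (s * x)).toReal + (c * x + d) : ℝ) : EReal) := by
    intro x hx
    rw [EReal.coe_add (ψ (s * x)).toReal, EReal.coe_toReal (htop _) hx]
  refine ⟨htop', lc_conc_bwd htop' ?_, ?_, ?_⟩
  · intro x y t ht0 ht1 hx hy
    have hx' := key x hx
    have hy' := key y hy
    obtain ⟨h1, h2⟩ := lc_conc_fwd hh ht0.le ht1.le hx' hy'
    have e : t * (s * x) + (1 - t) * (s * y) = s * (t * x + (1 - t) * y) := by ring
    rw [e] at h1 h2
    rw [key2 _ hx', key2 _ hy', key2 _ h1]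
    refine ⟨EReal.coe_ne_bot _, ?_⟩
    simp only [EReal.toReal_coe]
    nlinarith
  · apply UpperSemicontinuous.add'
    · exact husc.comp (continuous_const.mul continuous_id)
    · apply Continuous.upperSemicontinuous
      exact continuous_coe_real_ereal.comp (by fun_prop)
    · intro x
      exact EReal.continuousAt_add (.inr (EReal.coe_ne_bot _)) (.inr (EReal.coe_ne_top _))
  · apply lc_coercive (B + d) (s * b - |c|) (by linarith)
    intro x
    calc ψ (s * x) + ((c * x + d : ℝ) : EReal)
        ≤ ((B - b * |s * x| : ℝ) : EReal) + ((c * x + d : ℝ) : EReal) := by gcongr; exact hB _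
      _ ≤ _ := by
        rw [← EReal.coe_add]
        have h1 : c * x ≤ |c| * |x| := by rw [← abs_mul]; exact le_abs_self _
        have h2 : |s * x| = s * |x| := by rw [abs_mul, abs_of_pos hs]
        rw [h2]
        exact_mod_cast (by nlinarith)

theorem lc_negabs : MemPhi (fun x => ((- |x| : ℝ) : EReal)) := by
  refine ⟨fun x => EReal.coe_ne_top _, lc_conc_bwd (fun x => EReal.coe_ne_top _) ?_, ?_, ?_⟩
  · intro x y t ht0 ht1 _ _
    refine ⟨EReal.coe_ne_bot _, ?_⟩
    simp only [EReal.toReal_coe]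
    have := abs_add_le (t * x) ((1 - t) * y)
    rw [abs_mul, abs_mul, abs_of_pos ht0, abs_of_pos (by linarith : 0 < 1 - t)] at this
    linarith
  · apply Continuous.upperSemicontinuous
    exact continuous_coe_real_ereal.comp (by fun_prop)
  · apply lc_coercive 0 1 one_pos
    intro x
    simp

theorem lc_measE : Measurable expEReal := by
  unfold expEReal
  refine Measurable.ite (measurableSet_singleton _) measurable_const ?_
  refine Measurable.ite (measurableSet_singleton _) measurable_const ?_
  exact ENNReal.measurable_ofReal.comp (Real.measurable_exp.comp measurable_ereal_toReal)

theorem lc_expE_coe (r : ℝ) : expEReal (r : EReal) = ENNReal.ofReal (Real.exp r) := by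
  simp [expEReal]

theorem lc_expE_add (x : EReal) (hx : x ≠ ⊤) (c : ℝ) :
    expEReal (x + (c : EReal)) = expEReal x * ENNReal.ofReal (Real.exp c) := by
  induction x with
  | bot => simp [expEReal]
  | top => exact absurd rfl hx
  | coe r =>
    rw [← EReal.coe_add, lc_expE_coe, lc_expE_coe, Real.exp_add,
      ENNReal.ofReal_mul (Real.exp_pos _).le]

theorem lc_expE_mono {x : EReal} {r : ℝ} (h : x ≤ (r : EReal)) :
    expEReal x ≤ ENNReal.ofReal (Real.exp r) := by
  induction x with
  | bot => simp [expEReal]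
  | top => simp at h
  | coe a =>
    rw [lc_expE_coe]
    exact ENNReal.ofReal_le_ofReal (Real.exp_le_exp.mpr (by exact_mod_cast h))

theorem lc_int_exp_abs {b : ℝ} (hb : 0 < b) (B : ℝ) :
    Integrable (fun x : ℝ => Real.exp (B - b * |x|)) := by
  have h1 : Integrable (fun x : ℝ => Real.exp (- b * |x|)) := by
    rw [← integrableOn_univ, ← Set.Iic_union_Ioi (a := (0 : ℝ))]
    refine IntegrableOn.union ?_ ?_
    · refine (integrableOn_exp_mul_Iic hb 0).congr_fun (fun x hx => ?_) measurableSet_Iic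
      simp only
      rw [abs_of_nonpos hx]; congr 1; ring
    · refine (integrableOn_exp_mul_Ioi (a := -b) (by linarith) 0).congr_fun (fun x hx => ?_)
        measurableSet_Ioi
      simp only
      rw [abs_of_pos hx]
  have h2 := h1.const_mul (Real.exp B)
  refine h2.congr (ae_of_all _ fun x => ?_)
  simp only
  rw [← Real.exp_add]; congr 1; ring

theorem lc_I_fin {φ : ℝ → EReal} {B b : ℝ} (hb : 0 < b)
    (hB : ∀ x, φ x ≤ ((B - b * |x| : ℝ) : EReal)) : ∫⁻ x, expEReal (φ x) ≠ ⊤ := by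
  refine ne_top_of_le_ne_top ?_ (lintegral_mono fun x => lc_expE_mono (hB x))
  exact (lc_int_exp_abs hb B).lintegral_lt_top.ne

theorem lc_I_scale {ψ : ℝ → EReal} (hψ : MemPhi ψ) {s : ℝ} (hs : 0 < s) :
    ∫⁻ x, expEReal (ψ (s * x) + ((0 * x + Real.log s : ℝ) : EReal)) = ∫⁻ x, expEReal (ψ x) := by
  have hm : Measurable (fun x => expEReal (ψ x)) := lc_measE.comp hψ.2.2.1.measurable
  have h1 : ∀ x, expEReal (ψ (s * x) + ((0 * x + Real.log s : ℝ) : EReal))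
      = ENNReal.ofReal s * expEReal (ψ (s * x)) := by
    intro x
    rw [lc_expE_add _ (hψ.1 _), zero_mul, zero_add, Real.exp_log hs, mul_comm]
  simp_rw [h1]
  have h2 := Real.smul_map_volume_mul_left hs.ne'
  rw [abs_of_pos hs] at h2
  conv_rhs => rw [← h2]
  rw [lintegral_smul_measure, lintegral_map hm (by fun_prop), lintegral_const_mul' _ _ ENNReal.ofReal_ne_top]
  rfl

theorem lc_int_coe {R : Measure ℝ} {φ : ℝ → EReal} {g : ℝ → ℝ} (hg : Integrable g R)
    (h : ∀ᵐ x ∂(R), φ x = (g x : EReal)) : integralEReal R φ = ((∫ x, g x ∂(R) : ℝ) : EReal) := by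
  unfold integralEReal
  have e1 : ∫⁻ x, erealPosPart (φ x) ∂(R) = ∫⁻ x, ENNReal.ofReal (g x) ∂(R) := by
    refine lintegral_congr_ae ?_
    filter_upwards [h] with x hx
    simp [erealPosPart, hx]
  have e2 : ∫⁻ x, erealPosPart (-(φ x)) ∂(R) = ∫⁻ x, ENNReal.ofReal (-(g x)) ∂(R) := by
    refine lintegral_congr_ae ?_
    filter_upwards [h] with x hx
    rw [hx, ← EReal.coe_neg]
    simp [erealPosPart]
  have f1 : ∫⁻ x, ENNReal.ofReal (g x) ∂(R) ≠ ⊤ := hg.lintegral_lt_top.ne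
  have f2 : ∫⁻ x, ENNReal.ofReal (-(g x)) ∂(R) ≠ ⊤ := hg.neg.lintegral_lt_top.ne
  rw [e1, e2, integral_eq_lintegral_pos_part_sub_lintegral_neg_part hg, EReal.coe_sub,
    EReal.coe_ennreal_toReal f1, EReal.coe_ennreal_toReal f2]

theorem lc_int_ne_bot {R : Measure ℝ} [IsProbabilityMeasure R] {φ : ℝ → EReal}
    (hm : Measurable φ) {B : ℝ} (hB : ∀ x, φ x ≤ (B : EReal)) (h : integralEReal R φ ≠ ⊥) :
    (∀ᵐ x ∂(R), φ x ≠ ⊥) ∧ Integrable (fun x => (φ x).toReal) R := by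
  have htop : ∀ x, φ x ≠ ⊤ := fun x => ((hB x).trans_lt (EReal.coe_lt_top _)).ne
  unfold integralEReal at h
  have hmp : Measurable erealPosPart := by
    unfold erealPosPart
    refine Measurable.ite (measurableSet_singleton _) measurable_const ?_
    exact ENNReal.measurable_ofReal.comp measurable_ereal_toReal
  have hn : ∫⁻ x, erealPosPart (-(φ x)) ∂(R) ≠ ⊤ := by
    intro h1
    apply h
    rw [h1]
    simp
  have hae := ae_lt_top (hmp.comp hm.neg) hn
  have hnb : ∀ᵐ x ∂(R), φ x ≠ ⊥ := by
    filter_upwards [hae] with x hx hbot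
    simp [erealPosPart, hbot] at hx
  refine ⟨hnb, ?_⟩
  have hmr : Measurable (fun x => (φ x).toReal) := measurable_ereal_toReal.comp hm
  refine ⟨hmr.aestronglyMeasurable, ?_⟩
  rw [hasFiniteIntegral_iff_norm]
  have hle : ∫⁻ x, ENNReal.ofReal ‖(φ x).toReal‖ ∂(R) ≤
      ∫⁻ x, (ENNReal.ofReal |B| + erealPosPart (-(φ x))) ∂(R) := by
    refine lintegral_mono_ae ?_
    filter_upwards [hnb] with x hx
    have hb := hB x
    have : -φ x ≠ ⊤ := by simpa [EReal.neg_eq_top_iff] using hx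
    simp only [erealPosPart, this, if_false, EReal.toReal_neg_eq]
    have hb' : (φ x).toReal ≤ B := by
      rw [← EReal.coe_toReal (htop x) hx] at hb
      exact_mod_cast hb
    rcases le_total 0 (φ x).toReal with h0 | h0
    · rw [Real.norm_of_nonneg h0]
      exact le_add_right (ENNReal.ofReal_le_ofReal (hb'.trans (le_abs_self _)))
    · rw [Real.norm_of_nonpos h0]
      exact le_add_self
  refine hle.trans_lt ?_
  rw [lintegral_add_left measurable_const]
  simp [hn.lt_top]

theorem lc_basic {R : Measure ℝ} [IsProbabilityMeasure R] (hR : Integrable (fun x : ℝ => x) R)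
    {ψ : ℝ → EReal} (h : IsLogConcaveProj R ψ) :
    (∀ᵐ x ∂(R), ψ x ≠ ⊥) ∧ Integrable (fun x => (ψ x).toReal) R := by
  obtain ⟨B, b, hb, hB⟩ := lc_bound h.1
  refine lc_int_ne_bot h.1.2.2.1.measurable (B := B) (fun x => (hB x).trans ?_) ?_
  · have : 0 ≤ b * |x| := by positivity
    exact_mod_cast (by linarith)
  · intro hbot
    have h1 := h.2 _ lc_negabs
    rw [hbot, lc_int_coe (g := fun x => -|x|) hR.abs.neg (by simp)] at h1
    have h2 : ∫⁻ x : ℝ, expEReal ((-|x| : ℝ) : EReal) ≠ ⊤ :=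
      lc_I_fin (B := 0) (b := 1) one_pos (by simp)
    rw [← EReal.coe_ennreal_toReal h2, EReal.bot_sub, EReal.bot_add, ← EReal.coe_sub,
      ← EReal.coe_one, ← EReal.coe_add] at h1
    exact EReal.coe_ne_bot _ (le_bot_iff.mp h1)

theorem lc_pert_ineq {R : Measure ℝ} [IsProbabilityMeasure R]
    (hR : Integrable (fun x : ℝ => x) R)
    {ψ : ℝ → EReal} (h : IsLogConcaveProj R ψ) {B b : ℝ} (hb : 0 < b)
    (hB : ∀ x, ψ x ≤ ((B - b * |x| : ℝ) : EReal)) {s c d : ℝ} (hs : 0 < s) (hc : |c| < s * b)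
    (hne : ∀ᵐ x ∂(R), ψ (s * x) ≠ ⊥) (hint : Integrable (fun x => (ψ (s * x)).toReal) R)
    (hI : ∫⁻ x, expEReal (ψ (s * x) + ((c * x + d : ℝ) : EReal)) ≠ ⊤) :
    ∫ x, ((ψ (s * x)).toReal + (c * x + d)) ∂(R)
      - (∫⁻ x, expEReal (ψ (s * x) + ((c * x + d : ℝ) : EReal))).toReal
      ≤ ∫ x, (ψ x).toReal ∂(R) - (∫⁻ x, expEReal (ψ x)).toReal := by
  obtain ⟨h0, h0i⟩ := lc_basic hR h
  have h1 := h.2 _ (lc_pert h.1 hB (d := d) hs hc)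
  rw [lc_int_coe (g := fun x => (ψ (s * x)).toReal + (c * x + d))
      (hint.add ((hR.const_mul c).add (integrable_const d))) (by
        filter_upwards [hne] with x hx
        rw [EReal.coe_add (ψ (s * x)).toReal, EReal.coe_toReal (h.1.1 _) hx]),
    lc_int_coe (g := fun x => (ψ x).toReal) h0i (by
        filter_upwards [h0] with x hx
        rw [EReal.coe_toReal (h.1.1 _) hx]),
    ← EReal.coe_ennreal_toReal hI, ← EReal.coe_ennreal_toReal (lc_I_fin hb hB)] at h1
  have h2 := EReal.coe_le_coe_iff.mp (by simpa only [← EReal.coe_sub, ← EReal.coe_one, ← EReal.coe_add] using h1)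
  linarith

theorem lc_scale_ineq {R : Measure ℝ} [IsProbabilityMeasure R]
    (hR : Integrable (fun x : ℝ => x) R)
    {ψ : ℝ → EReal} (h : IsLogConcaveProj R ψ) {s : ℝ} (hs : 0 < s)
    (hne : ∀ᵐ x ∂(R), ψ (s * x) ≠ ⊥) (hint : Integrable (fun x => (ψ (s * x)).toReal) R) :
    ∫ x, (ψ (s * x)).toReal ∂(R) + Real.log s ≤ ∫ x, (ψ x).toReal ∂(R) := by
  obtain ⟨B, b, hb, hB⟩ := lc_bound h.1
  have h1 := lc_pert_ineq hR h hb hB (c := 0) (d := Real.log s) hs (by simp; positivity) hne hint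
    (by rw [lc_I_scale h.1 hs]; exact lc_I_fin hb hB)
  rw [lc_I_scale h.1 hs] at h1
  simp only [zero_mul, zero_add] at h1
  rw [integral_add hint (integrable_const _)] at h1
  simp at h1
  linarith

theorem lc_mean {R : Measure ℝ} [IsProbabilityMeasure R]
    (hR : Integrable (fun x : ℝ => x) R)
    {ψ : ℝ → EReal} (h : IsLogConcaveProj R ψ) :
    ∫ x, x ∂(R) = deriv (mgf id (volume.withDensity (fun x => expEReal (ψ x)))) 0 := by
  obtain ⟨B, b, hb, hB⟩ := lc_bound h.1
  obtain ⟨h0, h0i⟩ := lc_basic hR h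
  set ν := (volume : Measure ℝ).withDensity (fun x => expEReal (ψ x)) with hν
  have hm : Measurable (fun x => expEReal (ψ x)) := lc_measE.comp h.1.2.2.1.measurable
  have hbd : ∀ c : ℝ, |c| < b → ∀ x, ψ (1 * x) + ((c * x + 0 : ℝ) : EReal) ≤
      ((B - (b - |c|) * |x| : ℝ) : EReal) := by
    intro c hc x
    calc ψ (1 * x) + ((c * x + 0 : ℝ) : EReal)
        ≤ ((B - b * |x| : ℝ) : EReal) + ((c * x + 0 : ℝ) : EReal) := by
          rw [one_mul]; gcongr; exact hB _
      _ ≤ _ := by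
        rw [← EReal.coe_add]
        have h1 : c * x ≤ |c| * |x| := by rw [← abs_mul]; exact le_abs_self _
        exact_mod_cast (by nlinarith)
  have hfin : ∀ c : ℝ, |c| < b →
      ∫⁻ x, expEReal (ψ (1 * x) + ((c * x + 0 : ℝ) : EReal)) ≠ ⊤ := fun c hc =>
    lc_I_fin (by linarith : 0 < b - |c|) (hbd c hc)
  have heq : ∀ c : ℝ, ∫⁻ x, ENNReal.ofReal (Real.exp (c * x)) ∂ν =
      ∫⁻ x, expEReal (ψ (1 * x) + ((c * x + 0 : ℝ) : EReal)) := by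
    intro c
    rw [hν, lintegral_withDensity_eq_lintegral_mul _ hm (by fun_prop)]
    refine lintegral_congr fun x => ?_
    rw [lc_expE_add _ (h.1.1 _), one_mul, add_zero]
    rfl
  have hintc : ∀ c : ℝ, |c| < b → Integrable (fun x => Real.exp (c * id x)) ν := by
    intro c hc
    refine ⟨by fun_prop, ?_⟩
    rw [hasFiniteIntegral_iff_norm]
    simp only [Real.norm_eq_abs, Real.abs_exp, id]
    rw [heq c]
    exact (hfin c hc).lt_top
  have hmgf : ∀ c : ℝ, mgf id ν c =
      (∫⁻ x, expEReal (ψ (1 * x) + ((c * x + 0 : ℝ) : EReal))).toReal := by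
    intro c
    rw [mgf, integral_eq_lintegral_of_nonneg_ae (ae_of_all _ fun x => (Real.exp_pos _).le)
      (by fun_prop), ← heq c]
    rfl
  have hint0 : (0 : ℝ) ∈ interior (integrableExpSet id ν) := by
    rw [mem_interior]
    refine ⟨Metric.ball 0 b, ?_, Metric.isOpen_ball, by simp [hb]⟩
    intro c hc
    rw [Metric.mem_ball, dist_zero_right] at hc
    exact hintc c hc
  have hd := (differentiableAt_mgf hint0).hasDerivAt
  have hd2 : HasDerivAt (fun c => c * (∫ x, x ∂(R)) - mgf id ν c)
      (1 * (∫ x, x ∂(R)) - deriv (mgf id ν) 0) 0 :=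
    ((hasDerivAt_id (0 : ℝ)).mul_const _).sub hd
  have hmax : IsLocalMax (fun c => c * (∫ x, x ∂(R)) - mgf id ν c) 0 := by
    have : Metric.ball (0 : ℝ) b ∈ 𝓝 (0 : ℝ) := Metric.ball_mem_nhds _ hb
    filter_upwards [this] with c hc
    rw [Metric.mem_ball, dist_zero_right] at hc
    have h1 := lc_pert_ineq hR h hb hB (s := 1) (c := c) (d := 0) one_pos (by simpa using hc)
      (by simpa using h0) (by simpa using h0i) (hfin c hc)
    rw [← hmgf c] at h1
    have h2 : (∫⁻ x, expEReal (ψ x)).toReal = mgf id ν 0 := by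
      rw [hmgf 0]; simp
    rw [h2] at h1
    simp only [one_mul, add_zero] at h1
    rw [integral_add h0i (hR.const_mul c), integral_const_mul] at h1
    simp only [zero_mul]
    linarith
  have := hmax.hasDerivAt_eq_zero hd2
  linarith

theorem lc_slope {k : ℝ → ℝ} {S : Set ℝ} (hk : ConvexOn ℝ S k) {x y x' y' : ℝ}
    (hx : x ∈ S) (hy : y ∈ S) (hx' : x' ∈ S) (hy' : y' ∈ S)
    (h1 : x < y) (h2 : x' < y') (h3 : x ≤ x') (h4 : y ≤ y') :
    (k y - k x) / (y - x) ≤ (k y' - k x') / (y' - x') := by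
  have e1 := hk.secant_mono hx hy hy' h1.ne' (h1.trans_le h4).ne' h4
  have e2 := hk.secant_mono hy' hx hx' (h1.trans_le h4).ne h2.ne h3
  have e3 : (k x - k y') / (x - y') = (k y' - k x) / (y' - x) := by
    rw [← neg_div_neg_eq]; simp
  have e4 : (k x' - k y') / (x' - y') = (k y' - k x') / (y' - x') := by
    rw [← neg_div_neg_eq]; simp
  rw [e3, e4] at e2
  exact e1.trans e2

theorem lc_slope_log {k : ℝ → ℝ} {S : Set ℝ} (hk : ConvexOn ℝ S k) {m : ℝ} (hm : 0 < m)
    (hmS : m ∈ S) (hlog : ∀ c ∈ S, m < c → Real.log (c / m) ≤ k c - k m)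
    {c : ℝ} (hc : c ∈ S) (hmc : m < c) : 1 / m ≤ (k c - k m) / (c - m) := by
  have key : ∀ d, m < d → d ≤ c → 1 / d ≤ (k c - k m) / (c - m) := by
    intro d hd hdc
    have hdS : d ∈ S := hk.1.ordConnected.out hmS hc ⟨hd.le, hdc⟩
    have h1 := lc_slope hk hmS hdS hmS hc hd hmc le_rfl hdc
    refine le_trans ?_ h1
    have hd0 : 0 < d := hm.trans hd
    rw [le_div_iff₀ (by linarith)]
    refine le_trans ?_ (hlog d hdS hd)
    have := Real.one_sub_inv_le_log_of_pos (div_pos hd0 hm)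
    refine le_trans (le_of_eq ?_) this
    field_simp
  have ht : Tendsto (fun d : ℝ => 1 / d) (𝓝[>] m) (𝓝 (1 / m)) := by
    have : ContinuousAt (fun d : ℝ => 1 / d) m := by
      apply ContinuousAt.div continuousAt_const continuousAt_id hm.ne'
    exact this.tendsto.mono_left nhdsWithin_le_nhds
  refine le_of_tendsto ht ?_
  filter_upwards [Ioc_mem_nhdsGT hmc] with d hd
  exact key d hd.1 hd.2

def lcS (ψ : ℝ → EReal) (Q : Measure ℝ) : Set ℝ :=
  {a | (∀ᵐ y ∂Q, ψ (a * y) ≠ ⊥) ∧ Integrable (fun y => (ψ (a * y)).toReal) Q}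

noncomputable def lcK (ψ : ℝ → EReal) (Q : Measure ℝ) (a : ℝ) : ℝ := - ∫ y, (ψ (a * y)).toReal ∂Q

theorem lc_meas {ψ : ℝ → EReal} (h : MemPhi ψ) : Measurable (fun x => (ψ x).toReal) :=
  measurable_ereal_toReal.comp h.2.2.1.measurable

theorem lc_toReal_bdd {ψ : ℝ → EReal} (h : MemPhi ψ) : ∃ B : ℝ, ∀ x, (ψ x).toReal ≤ B := by
  obtain ⟨B, b, hb, hB⟩ := lc_bound h
  refine ⟨|B|, fun x => ?_⟩
  by_cases hx : ψ x = ⊥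
  · rw [hx]; simp
  have := hB x
  rw [← EReal.coe_toReal (h.1 x) hx] at this
  have h1 : (ψ x).toReal ≤ B - b * |x| := by exact_mod_cast this
  have h2 : 0 ≤ b * |x| := by positivity
  have := le_abs_self B
  linarith

theorem lc_convexK {ψ : ℝ → EReal} (h : MemPhi ψ) (Q : Measure ℝ) [IsProbabilityMeasure Q] :
    ConvexOn ℝ (lcS ψ Q) (lcK ψ Q) := by
  obtain ⟨B, hB⟩ := lc_toReal_bdd h
  have key : ∀ x ∈ lcS ψ Q, ∀ y ∈ lcS ψ Q, ∀ t : ℝ, 0 ≤ t → t ≤ 1 →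
      ∀ᵐ z ∂Q, ψ ((t * x + (1 - t) * y) * z) ≠ ⊥ ∧
      t * (ψ (x * z)).toReal + (1 - t) * (ψ (y * z)).toReal
        ≤ (ψ ((t * x + (1 - t) * y) * z)).toReal := by
    intro x hx y hy t ht0 ht1
    filter_upwards [hx.1, hy.1] with z hz1 hz2
    have := lc_conc_fwd h ht0 ht1 hz1 hz2
    have e : t * (x * z) + (1 - t) * (y * z) = (t * x + (1 - t) * y) * z := by ring
    rwa [e] at this
  have keyS : ∀ x ∈ lcS ψ Q, ∀ y ∈ lcS ψ Q, ∀ t : ℝ, 0 ≤ t → t ≤ 1 →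
      t * x + (1 - t) * y ∈ lcS ψ Q := by
    intro x hx y hy t ht0 ht1
    have hk := key x hx y hy t ht0 ht1
    refine ⟨hk.mono fun z hz => hz.1, ?_⟩
    refine integrable_of_le_of_le ?_ (hk.mono fun z hz => hz.2) (ae_of_all _ fun z => hB _)
      ((hx.2.const_mul t).add (hy.2.const_mul (1 - t))) (integrable_const B)
    exact ((lc_meas h).comp (by fun_prop)).aestronglyMeasurable
  refine ⟨?_, ?_⟩
  · intro x hx y hy a b ha hb hab
    have e : b = 1 - a := by linarith
    subst e
    exact keyS x hx y hy a ha (by linarith)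
  · intro x hx y hy a b ha hb hab
    have e : b = 1 - a := by linarith
    subst e
    have hS := keyS x hx y hy a ha (by linarith)
    have hk := key x hx y hy a ha (by linarith)
    have h1 := integral_mono_ae ((hx.2.const_mul a).add (hy.2.const_mul (1 - a))) hS.2
      (hk.mono fun z hz => hz.2)
    simp only [Pi.add_apply] at h1
    rw [integral_add (hx.2.const_mul a) (hy.2.const_mul (1 - a)), integral_const_mul,
      integral_const_mul] at h1
    simp only [lcK, smul_eq_mul]
    linarith

theorem lc_transfer {ψ : ℝ → EReal} (h : MemPhi ψ) {L Q R : Measure ℝ} [IsProbabilityMeasure L]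
    [IsProbabilityMeasure Q] (hR : R = (L.prod Q).map (fun p => p.1 * p.2)) (s : ℝ)
    (hne : ∀ᵐ x ∂(R), ψ (s * x) ≠ ⊥) (hint : Integrable (fun x => (ψ (s * x)).toReal) R) :
    (∀ᵐ a ∂L, s * a ∈ lcS ψ Q) ∧ Integrable (fun a => lcK ψ Q (s * a)) L ∧
      ∫ x, (ψ (s * x)).toReal ∂(R) = - ∫ a, lcK ψ Q (s * a) ∂L := by
  have hmm : Measurable (fun p : ℝ × ℝ => p.1 * p.2) := by fun_prop
  have hfm : Measurable (fun x => (ψ (s * x)).toReal) := (lc_meas h).comp (by fun_prop)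
  rw [hR] at hne hint
  have hne' := Measure.ae_ae_of_ae_prod (ae_of_ae_map hmm.aemeasurable hne)
  have hint' : Integrable (fun p : ℝ × ℝ => (ψ (s * (p.1 * p.2))).toReal) (L.prod Q) :=
    hint.comp_measurable hmm
  refine ⟨?_, ?_, ?_⟩
  · filter_upwards [hne', hint'.prod_right_ae] with a h1 h2
    simp only [lcS, Set.mem_ofPred_eq, mul_assoc]
    exact ⟨h1, h2⟩
  · simp only [lcK, mul_assoc]
    exact hint'.integral_prod_left.neg
  · rw [hR, integral_map hmm.aemeasurable hfm.aestronglyMeasurable, integral_prod _ hint']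
    simp only [lcK, mul_assoc, integral_neg, neg_neg]

theorem lc_meanR {L Q R : Measure ℝ} [IsProbabilityMeasure L]
    [IsProbabilityMeasure Q] (hR : R = (L.prod Q).map (fun p => p.1 * p.2))
    (hL : Integrable (fun x : ℝ => x) L) (hQ : Integrable (fun x : ℝ => x) Q) :
    Integrable (fun x : ℝ => x) R ∧ ∫ x, x ∂(R) = (∫ x, x ∂L) * ∫ x, x ∂Q := by
  have hmm : Measurable (fun p : ℝ × ℝ => p.1 * p.2) := by fun_prop
  have h1 : Integrable (fun p : ℝ × ℝ => p.1 * p.2) (L.prod Q) := hL.mul_prod hQ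
  subst hR
  refine ⟨(integrable_map_measure (by fun_prop) hmm.aemeasurable).mpr h1, ?_⟩
  rw [integral_map hmm.aemeasurable (by fun_prop)]
  exact integral_prod_mul (fun x : ℝ => x) (fun x : ℝ => x)

theorem lc_zero {ψ : ℝ → EReal} (h : MemPhi ψ) {Q : Measure ℝ} [IsProbabilityMeasure Q]
    (hQ : Integrable (fun x : ℝ => x) Q) (h0 : ∫ x, x ∂Q = 0) {a : ℝ}
    (ha : ∀ᵐ y ∂Q, ψ (a * y) ≠ ⊥) : ψ 0 ≠ ⊥ := by
  obtain ⟨y1, hy1, hy1'⟩ := exists_notMem_null_le_integral hQ (ae_iff.mp ha)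
  obtain ⟨y2, hy2, hy2'⟩ := exists_notMem_null_integral_le hQ (ae_iff.mp ha)
  rw [h0] at hy1' hy2'
  have k1 : ψ (a * y1) ≠ ⊥ := by
    intro hh; exact hy1 (by simpa using hh)
  have k2 : ψ (a * y2) ≠ ⊥ := by
    intro hh; exact hy2 (by simpa using hh)
  rcases hy1'.eq_or_lt with e | hlt
  · rwa [e, mul_zero] at k1
  have hpos : 0 < y2 - y1 := by linarith
  have := (lc_conc_fwd h (t := y2 / (y2 - y1)) (by positivity)
    (by rw [div_le_one hpos]; linarith) k1 k2).1
  have e : y2 / (y2 - y1) * (a * y1) + (1 - y2 / (y2 - y1)) * (a * y2) = 0 := by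
    field_simp; ring
  rwa [e] at this

theorem lc_lower {Ll Q Rl : Measure ℝ} [IsProbabilityMeasure Ll] [IsProbabilityMeasure Q]
    (hRl : Rl = (Ll.prod Q).map (fun p => p.1 * p.2)) [IsProbabilityMeasure Rl]
    (hR : Integrable (fun x : ℝ => x) Rl) {ψ : ℝ → EReal} (h : IsLogConcaveProj Rl ψ)
    (hL : Integrable (fun x : ℝ => x) Ll)
    {m : ℝ} (hm : 0 < m) (hl : ∀ᵐ a ∂Ll, 0 < a ∧ a ≤ m) (h0 : ψ 0 ≠ ⊥)
    {c : ℝ} (hc : c ∈ lcS ψ Q) (hmS : m ∈ lcS ψ Q) (hmc : m < c) :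
    Real.log (c / m) ≤ lcK ψ Q c - lcK ψ Q m := by
  obtain ⟨B, hB⟩ := lc_toReal_bdd h.1
  have hmm : Measurable (fun p : ℝ × ℝ => p.1 * p.2) := by fun_prop
  have hconv := lc_convexK h.1 Q
  set s := c / m with hs
  have hs1 : 1 < s := by rw [hs, one_lt_div hm]; exact hmc
  have hs0 : 0 < s := by linarith
  have hfm : Measurable (fun x => (ψ (s * x)).toReal) := (lc_meas h.1).comp (by fun_prop)
  have hsm : s * m = c := by rw [hs]; field_simp
  have hprod : ∀ᵐ p ∂(Ll.prod Q), ψ (s * (p.1 * p.2)) ≠ ⊥ ∧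
      (p.1 / m) * (ψ (c * p.2)).toReal + (1 - p.1 / m) * (ψ 0).toReal
        ≤ (ψ (s * (p.1 * p.2))).toReal := by
    filter_upwards [Measure.quasiMeasurePreserving_fst.ae hl,
      Measure.quasiMeasurePreserving_snd.ae hc.1] with p h1 h2
    have := lc_conc_fwd h.1 (t := p.1 / m) (div_nonneg h1.1.le hm.le)
      (by rw [div_le_one hm]; exact h1.2) h2 h0
    have e : p.1 / m * (c * p.2) + (1 - p.1 / m) * 0 = s * (p.1 * p.2) := by
      rw [hs]; field_simp; ring
    rwa [e] at this
  have hne : ∀ᵐ x ∂(Rl), ψ (s * x) ≠ ⊥ := by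
    rw [hRl, ae_map_iff hmm.aemeasurable]
    · exact hprod.mono fun p hp => hp.1
    · have : Measurable (fun x => ψ (s * x)) := h.1.2.2.1.measurable.comp (by fun_prop)
      exact (this (measurableSet_singleton ⊥)).compl
  have hLm : Integrable (fun a : ℝ => a / m) Ll := hL.div_const m
  have hint : Integrable (fun x => (ψ (s * x)).toReal) Rl := by
    rw [hRl, integrable_map_measure hfm.aestronglyMeasurable hmm.aemeasurable]
    refine integrable_of_le_of_le (hfm.comp hmm).aestronglyMeasurable
      (hprod.mono fun p hp => hp.2) (ae_of_all _ fun z => hB _) ?_ (integrable_const B)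
    refine (hLm.mul_prod hc.2).add ?_
    exact (((integrable_const (1 : ℝ)).sub hLm).comp_fst Q).mul_const _
  have hineq := lc_scale_ineq hR h hs0 hne hint
  obtain ⟨hb1, hb2⟩ := lc_basic hR h
  obtain ⟨-, i1, e1⟩ := lc_transfer h.1 hRl s hne hint
  obtain ⟨a2, i2, e2⟩ := lc_transfer h.1 hRl 1 (by simpa using hb1) (by simpa using hb2)
  simp only [one_mul] at a2 i2 e2
  obtain ⟨a1, -, -⟩ := lc_transfer h.1 hRl s hne hint
  rw [e1, e2] at hineq
  have hle : ∫ a, (lcK ψ Q (s * a) - lcK ψ Q a) ∂Ll ≤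
      ∫ a, (a / m) * (lcK ψ Q c - lcK ψ Q m) ∂Ll := by
    refine integral_mono_ae (i1.sub i2) (hLm.mul_const _) ?_
    filter_upwards [hl, a1, a2] with a ha ha1 ha2
    have hsa : a < s * a := by nlinarith [ha.1]
    have := lc_slope hconv ha2 ha1 hmS hc hsa hmc ha.2
      (by rw [← hsm]; exact mul_le_mul_of_nonneg_left ha.2 hs0.le)
    have e3 : s * a - a = (c - m) * (a / m) := by rw [← hsm]; field_simp
    have ham : 0 < a / m := div_pos ha.1 hm
    rw [e3, div_le_div_iff₀ (by nlinarith) (by linarith)] at this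
    have hcm : 0 < c - m := by linarith
    nlinarith
  rw [integral_sub i1 i2, integral_mul_const] at hle
  have hlog : 0 < Real.log s := Real.log_pos hs1
  have hE1 : ∫ a, a / m ∂Ll ≤ 1 := by
    have : ∫ a, a / m ∂Ll ≤ ∫ a, (1 : ℝ) ∂Ll := by
      refine integral_mono_ae hLm (integrable_const _) ?_
      filter_upwards [hl] with a ha
      rw [div_le_one hm]; exact ha.2
    simpa using this
  have hE0 : 0 ≤ ∫ a, a / m ∂Ll := by
    refine integral_nonneg_of_ae ?_
    filter_upwards [hl] with a ha
    exact div_nonneg ha.1.le hm.le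
  have h5 : Real.log s ≤ (∫ a, a / m ∂Ll) * (lcK ψ Q c - lcK ψ Q m) := by linarith
  have h6 : 0 ≤ lcK ψ Q c - lcK ψ Q m := by
    by_contra hcon
    push Not at hcon
    nlinarith
  nlinarith

theorem lc_core {Lu Ll Q Ru Rl : Measure ℝ} [IsProbabilityMeasure Lu] [IsProbabilityMeasure Ll]
    [IsProbabilityMeasure Q] [IsProbabilityMeasure Ru] [IsProbabilityMeasure Rl]
    (hRu : Ru = (Lu.prod Q).map (fun p => p.1 * p.2))
    (hRl : Rl = (Ll.prod Q).map (fun p => p.1 * p.2))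
    (hLu : Integrable (fun x : ℝ => x) Lu) (hQ : Integrable (fun x : ℝ => x) Q)
    {m : ℝ} (hm : 0 < m) (hu : ∀ᵐ a ∂Lu, m < a) (hl : ∀ᵐ a ∂Ll, 0 < a ∧ a ≤ m)
    {ψ : ℝ → EReal} (hψu : IsLogConcaveProj Ru ψ) (hψl : IsLogConcaveProj Rl ψ) : False := by
  have hLl : Integrable (fun x : ℝ => x) Ll := by
    refine integrable_of_le_of_le (by fun_prop) (hl.mono fun a ha => ha.1.le)
      (hl.mono fun a ha => ha.2) (integrable_const 0) (integrable_const m)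
  obtain ⟨hiu, heu⟩ := lc_meanR hRu hLu hQ
  obtain ⟨hil, hel⟩ := lc_meanR hRl hLl hQ
  have hEu : m < ∫ a, a ∂Lu := by
    by_contra hcon
    push Not at hcon
    have hnn : 0 ≤ᵐ[Lu] fun a => a - m := hu.mono fun a ha => by
      simp only [Pi.zero_apply]; linarith
    have hi : Integrable (fun a : ℝ => a - m) Lu := hLu.sub (integrable_const m)
    have h1 : ∫ a, (a - m) ∂Lu = 0 := by
      apply le_antisymm _ (integral_nonneg_of_ae hnn)
      rw [integral_sub hLu (integrable_const m)]
      simp; linarith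
    have h2 := (integral_eq_zero_iff_of_nonneg_ae hnn hi).mp h1
    obtain ⟨a, ha1, ha2⟩ := (hu.and h2).exists
    simp only [Pi.zero_apply] at ha2
    linarith
  have hEl : ∫ a, a ∂Ll ≤ m := by
    have := integral_mono_ae hLl (integrable_const m) (hl.mono fun a ha => ha.2)
    simpa using this
  have hmean : ∫ x, x ∂Q = 0 := by
    have e : ∫ x, x ∂(Ru) = ∫ x, x ∂(Rl) := (lc_mean hiu hψu).trans (lc_mean hil hψl).symm
    rw [heu, hel] at e
    have : (∫ a, a ∂Lu - ∫ a, a ∂Ll) * ∫ x, x ∂Q = 0 := by linarith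
    rcases mul_eq_zero.mp this with h | h
    · linarith
    · exact h
  obtain ⟨hb1, hb2⟩ := lc_basic hiu hψu
  obtain ⟨a2, i2, e2⟩ := lc_transfer hψu.1 hRu 1 (by simpa using hb1) (by simpa using hb2)
  simp only [one_mul] at a2 i2 e2
  obtain ⟨b, hbm, hbS⟩ := (hu.and a2).exists
  have h0 : ψ 0 ≠ ⊥ := lc_zero hψu.1 hQ hmean hbS.1
  have h0S : (0 : ℝ) ∈ lcS ψ Q := by
    refine ⟨by simpa using h0, by simp⟩
  have hconv := lc_convexK hψu.1 Q
  have hseg : ∀ a ∈ lcS ψ Q, ∀ x, 0 ≤ x → x ≤ a → x ∈ lcS ψ Q := fun a ha x hx0 hxa =>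
    hconv.1.ordConnected.out h0S ha ⟨hx0, hxa⟩
  have hmS : m ∈ lcS ψ Q := hseg b hbS m hm.le hbm.le
  have hm2S : m / 2 ∈ lcS ψ Q := hseg m hmS _ (by linarith) (by linarith)
  have hslope : ∀ c ∈ lcS ψ Q, m < c → 1 / m ≤ (lcK ψ Q c - lcK ψ Q m) / (c - m) :=
    fun c hc hmc => lc_slope_log hconv hm hmS
      (fun c hc hmc => lc_lower hRl hil hψl hLl hm hl h0 hc hmS hmc) hc hmc
  set C := (lcK ψ Q (m / 2) - lcK ψ Q 0) / (m / 2 - 0) with hC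
  obtain ⟨B, hB⟩ := lc_toReal_bdd hψu.1
  -- the weight function
  let w : ℝ → ℝ → ℝ := fun t a => if m < t * a then a * (1 / m) else a * C
  have hwm : ∀ t, Measurable (w t) := fun t =>
    Measurable.ite (measurableSet_lt measurable_const (by fun_prop)) (by fun_prop) (by fun_prop)
  have hwb : ∀ t a, ‖w t a‖ ≤ |a| * (1 / m + |C|) := by
    intro t a
    simp only [w]
    have hm' : 0 < 1 / m := by positivity
    split_ifs
    · rw [norm_mul, Real.norm_eq_abs, Real.norm_eq_abs, abs_of_pos hm']
      gcongr
      linarith [abs_nonneg C]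
    · rw [norm_mul, Real.norm_eq_abs, Real.norm_eq_abs]
      gcongr
      linarith
  have hbi : Integrable (fun a : ℝ => |a| * (1 / m + |C|)) Lu := hLu.abs.mul_const _
  have hwi : ∀ t, Integrable (w t) Lu := fun t =>
    hbi.mono' (hwm t).aestronglyMeasurable (ae_of_all _ fun a => hwb t a)
  have main : ∀ t : ℝ, 1 / 2 ≤ t → t < 1 → ∫ a, w t a ∂Lu ≤ 1 / t := by
    intro t ht ht1
    have ht0 : 0 < t := by linarith
    have hcomb : ∀ᵐ x ∂(Ru), ψ (t * x) ≠ ⊥ ∧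
        t * (ψ x).toReal + (1 - t) * (ψ 0).toReal ≤ (ψ (t * x)).toReal := by
      filter_upwards [hb1] with x hx
      have := lc_conc_fwd hψu.1 ht0.le ht1.le hx h0
      simpa using this
    have hne : ∀ᵐ x ∂(Ru), ψ (t * x) ≠ ⊥ := hcomb.mono fun x hx => hx.1
    have hint : Integrable (fun x => (ψ (t * x)).toReal) Ru := by
      refine integrable_of_le_of_le ((lc_meas hψu.1).comp (by fun_prop)).aestronglyMeasurable
        (hcomb.mono fun x hx => hx.2) (ae_of_all _ fun z => hB _)
        ((hb2.const_mul t).add (integrable_const _)) (integrable_const B)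
    have hineq := lc_scale_ineq hiu hψu ht0 hne hint
    obtain ⟨-, i1, e1⟩ := lc_transfer hψu.1 hRu t hne hint
    rw [e1, e2] at hineq
    have hle : ∫ a, (1 - t) * w t a ∂Lu ≤ ∫ a, (lcK ψ Q a - lcK ψ Q (t * a)) ∂Lu := by
      refine integral_mono_ae ((hwi t).const_mul _) (i2.sub i1) ?_
      filter_upwards [hu, a2] with a ha haS
      have ha0 : 0 < a := hm.trans ha
      have htaa : t * a < a := by nlinarith
      have htaS : t * a ∈ lcS ψ Q := hseg a haS _ (by positivity) htaa.le
      have hpos : 0 < (1 - t) * a := mul_pos (by linarith) ha0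
      have e3 : a - t * a = (1 - t) * a := by ring
      simp only [w]
      split_ifs with hcase
      · have h1 := hslope (t * a) htaS hcase
        have h2 := lc_slope hconv hmS htaS htaS haS hcase htaa hcase.le htaa.le
        have h3 := h1.trans h2
        rw [e3, le_div_iff₀ hpos] at h3
        linarith
      · have h2 := lc_slope hconv h0S hm2S htaS haS (by linarith) htaa (by positivity)
          (by linarith)
        rw [← hC, e3, le_div_iff₀ hpos] at h2
        linarith
    rw [integral_const_mul, integral_sub i2 i1] at hle
    have hlog := Real.one_sub_inv_le_log_of_pos ht0
    have h7 : (1 - t) * ∫ a, w t a ∂Lu ≤ (1 - t) * (1 / t) := by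
      have : (1 - t) * (1 / t) = t⁻¹ - 1 := by field_simp
      linarith
    exact le_of_mul_le_mul_left h7 (by linarith)
  -- the limit
  have htend : Tendsto (fun t : ℝ => ∫ a, w t a ∂Lu) (𝓝[<] 1) (𝓝 (∫ a, a * (1 / m) ∂Lu)) := by
    refine tendsto_integral_filter_of_dominated_convergence _
      (Eventually.of_forall fun t => (hwm t).aestronglyMeasurable)
      (Eventually.of_forall fun t => ae_of_all _ fun a => hwb t a) hbi ?_
    filter_upwards [hu] with a ha
    have hcont : Tendsto (fun t : ℝ => t * a) (𝓝[<] 1) (𝓝 (1 * a)) :=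
      ((continuous_id.mul continuous_const).tendsto 1).mono_left nhdsWithin_le_nhds
    rw [one_mul] at hcont
    refine tendsto_const_nhds.congr' ?_
    filter_upwards [hcont.eventually (lt_mem_nhds ha)] with t ht
    simp only [w, if_pos ht]
  have htend2 : Tendsto (fun t : ℝ => 1 / t) (𝓝[<] 1) (𝓝 (1 / 1)) := by
    have : ContinuousAt (fun d : ℝ => 1 / d) 1 :=
      ContinuousAt.div continuousAt_const continuousAt_id one_ne_zero
    exact this.tendsto.mono_left nhdsWithin_le_nhds
  have hfin := le_of_tendsto_of_tendsto htend htend2 (by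
    filter_upwards [Ico_mem_nhdsLT (by norm_num : (1 / 2 : ℝ) < 1)] with t ht
    exact main t ht.1 ht.2)
  rw [integral_mul_const, mul_one_div, div_le_iff₀ hm] at hfin
  linarith

/-- **Lemma A.5 (Distinct log-concave projections under multiplicative scaling).**
If `Xᵤ` and `Xₗ` are independent of `Y`, `Law(Y) ∈ 𝒬*`, `E|Xᵤ| < ∞`, and for some
`m > 0`, `Xᵤ > m` a.s. while `0 < Xₗ ≤ m` a.s., then the log-concave projections of the
laws of `XᵤY` and `XₗY` differ. -/
theorem logconcave_proj_ne_of_scaling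
    {Ω : Type*} [MeasurableSpace Ω] (μ : Measure Ω) [IsProbabilityMeasure μ]
    (Xu Xl Y : Ω → ℝ)
    (hXu : Measurable Xu) (hXl : Measurable Xl) (hY : Measurable Y)
    (hindu : IndepFun Xu Y μ) (hindl : IndepFun Xl Y μ)
    (hXuint : Integrable Xu μ)
    (hQ : MemQstar (μ.map Y))
    (m : ℝ) (hm : 0 < m)
    (hu : ∀ᵐ ω ∂μ, m < Xu ω)
    (hl : ∀ᵐ ω ∂μ, 0 < Xl ω ∧ Xl ω ≤ m)
    (ψu ψl : ℝ → EReal)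
    (hψu : IsLogConcaveProj (μ.map (fun ω => Xu ω * Y ω)) ψu)
    (hψl : IsLogConcaveProj (μ.map (fun ω => Xl ω * Y ω)) ψl) :
    ψu ≠ ψl := by
  rintro rfl
  obtain ⟨hQp, hQi, -⟩ := hQ
  have := Measure.isProbabilityMeasure_map (μ := μ) hXu.aemeasurable
  have := Measure.isProbabilityMeasure_map (μ := μ) hXl.aemeasurable
  have := Measure.isProbabilityMeasure_map (μ := μ) (hXu.mul hY).aemeasurable
  have := Measure.isProbabilityMeasure_map (μ := μ) (hXl.mul hY).aemeasurable
  have hmm : Measurable (fun p : ℝ × ℝ => p.1 * p.2) := by fun_prop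
  have hRu : μ.map (fun ω => Xu ω * Y ω) =
      ((μ.map Xu).prod (μ.map Y)).map (fun p => p.1 * p.2) := by
    rw [← hindu.map_prod_eq_prod_map_map hXu.aemeasurable hY.aemeasurable,
      Measure.map_map hmm (hXu.prodMk hY)]
    rfl
  have hRl : μ.map (fun ω => Xl ω * Y ω) =
      ((μ.map Xl).prod (μ.map Y)).map (fun p => p.1 * p.2) := by
    rw [← hindl.map_prod_eq_prod_map_map hXl.aemeasurable hY.aemeasurable,
      Measure.map_map hmm (hXl.prodMk hY)]
    rfl
  have hu' : ∀ᵐ a ∂(μ.map Xu), m < a :=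
    (ae_map_iff hXu.aemeasurable measurableSet_Ioi).mpr hu
  have hl' : ∀ᵐ a ∂(μ.map Xl), 0 < a ∧ a ≤ m :=
    (ae_map_iff hXl.aemeasurable measurableSet_Ioc).mpr hl
  have hLu : Integrable (fun x : ℝ => x) (μ.map Xu) :=
    (integrable_map_measure (by fun_prop) hXu.aemeasurable).mpr hXuint
  exact lc_core hRu hRl hLu hQi hm hu' hl' hψu hψl
end

section
/- Uniform Glivenko–Cantelli theorem in the Lévy–Prokhorov metric for ergodic parametric families (point (c) of the proof of Theorem 2.3, abstracted as proved there). Let (Ω, ℱ, μ) be a probability space, T : Ω → Ω an ergodic measure-preserving transformation, Θ ⊆ ℝ^d a compact set, and g : Θ × Ω → ℝ a jointly measurable function such that θ ↦ g(θ, ω) is continuous on Θ for every ω ∈ Ω. For θ ∈ Θ, n ≥ 1 and ω ∈ Ω define the empirical distribution Q_{n,θ}(ω) = (1/n) Σ_{t=1}^n δ_{g(θ, T^t ω)}, and let Q_θ be the distribution of g(θ, ·) under μ. Then for μ-almost every ω, sup_{θ ∈ Θ} D_L(Q_{n,θ}(ω), Q_θ) → 0 as n → ∞. -/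
open MeasureTheory ProbabilityTheory Filter Topology
open scoped ENNReal NNReal

set_option linter.unusedSectionVars false
namespace UGC
noncomputable def M {Ω : Type*} (T : Ω → Ω) (f : Ω → ℝ) : ℕ → Ω → ℝ
  | 0 => fun _ => 0
  | n+1 => fun ω => max 0 (f ω + M T f n (T ω))

section
variable {Ω : Type*} [MeasurableSpace Ω] {T : Ω → Ω} {f : Ω → ℝ}

lemma M_nonneg (n : ℕ) (ω : Ω) : 0 ≤ M T f n ω := by
  cases n <;> simp [M]

lemma M_mono (n : ℕ) (ω : Ω) : M T f n ω ≤ M T f (n+1) ω := by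
  induction n generalizing ω with
  | zero => simp [M]
  | succ n ih =>
    rw [M, M.eq_2 T f (n+1)]
    have := ih (T ω)
    exact max_le_max le_rfl (by linarith)

lemma M_meas (hT : Measurable T) (hf : Measurable f) (n : ℕ) : Measurable (M T f n) := by
  induction n with
  | zero => exact measurable_const
  | succ n ih => exact measurable_const.max (hf.add (ih.comp hT))

lemma M_le {K : ℝ} (hK : ∀ ω, |f ω| ≤ K) (n : ℕ) (ω : Ω) : M T f n ω ≤ n * K := by
  induction n generalizing ω with
  | zero => simp [M]
  | succ n ih =>
    rw [M]
    have h0 : 0 ≤ K := (abs_nonneg _).trans (hK ω)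
    have h1 := (abs_le.1 (hK ω)).2
    have h2 := ih (T ω)
    push_cast
    apply max_le
    · positivity
    · linarith

lemma sum_le_M (n : ℕ) (ω : Ω) : ∑ t ∈ Finset.range n, f (T^[t] ω) ≤ M T f n ω := by
  induction n generalizing ω with
  | zero => simp [M]
  | succ n ih =>
    rw [M, Finset.sum_range_succ']
    have := ih (T ω)
    simp only [Function.iterate_succ, Function.comp, Function.iterate_zero, id] at *
    refine le_max_of_le_right ?_
    linarith

lemma bdd_of_neg {μ : Measure Ω} [IsProbabilityMeasure μ] (hT : Ergodic T μ) (hf : Measurable f)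
    {K : ℝ} (hK : ∀ ω, |f ω| ≤ K) (hneg : ∫ ω, f ω ∂μ < 0) :
    ∀ᵐ ω ∂μ, ∃ k : ℕ, ∀ n, M T f n ω ≤ k := by
  have hTm : Measurable T := hT.measurable
  set A : Set Ω := {ω | ∃ k : ℕ, ∀ n, M T f n ω ≤ k} with hA
  have hAm : MeasurableSet A := by
    have : A = ⋃ k : ℕ, ⋂ n, {ω | M T f n ω ≤ k} := by ext; simp [A]
    rw [this]
    exact MeasurableSet.iUnion fun k => MeasurableSet.iInter fun n =>
      measurableSet_le (M_meas hTm hf n) measurable_const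
  have hinv : T ⁻¹' A = A := by
    ext ω
    simp only [A, Set.mem_preimage, Set.mem_ofPred_eq]
    constructor
    · rintro ⟨k, hk⟩
      obtain ⟨k', hk'⟩ := exists_nat_ge (|f ω| + k)
      refine ⟨k', fun n => (M_mono n ω).trans ?_⟩
      rw [M]
      have := hk n
      have := le_abs_self (f ω)
      have := abs_nonneg (f ω)
      exact max_le (by positivity) (by linarith)
    · rintro ⟨k, hk⟩
      obtain ⟨k', hk'⟩ := exists_nat_ge (|f ω| + k)
      refine ⟨k', fun n => ?_⟩
      have h1 := hk (n+1)
      rw [M] at h1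
      have := (le_max_right _ _).trans h1
      have := neg_abs_le (f ω)
      linarith
  rcases hT.toPreErgodic.aeconst_set hAm hinv |> Filter.eventuallyConst_set.1 with h | h
  · filter_upwards [h] with ω hω using hω
  · exfalso
    have hint : ∀ n, Integrable (M T f n) μ := fun n =>
      Integrable.of_bound (M_meas hTm hf n).aestronglyMeasurable (n * K)
        (Eventually.of_forall fun ω => by
          rw [Real.norm_of_nonneg (M_nonneg n ω)]; exact M_le hK n ω)
    have hintT : ∀ n, Integrable (fun ω => M T f n (T ω)) μ := fun n =>
      hT.toMeasurePreserving.integrable_comp_of_integrable (hint n)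
    have hintTe : ∀ n, ∫ ω, M T f n (T ω) ∂μ = ∫ ω, M T f n ω ∂μ := fun n => by
      have := integral_map (μ := μ) (f := M T f n) hTm.aemeasurable
        (M_meas hTm hf n).aestronglyMeasurable
      rw [hT.toMeasurePreserving.map_eq] at this
      exact this.symm
    have hlim : Tendsto (fun n => ∫ ω, (M T f (n+1) ω - M T f n (T ω)) ∂μ) atTop
        (𝓝 (∫ ω, f ω ∂μ)) := by
      apply tendsto_integral_of_dominated_convergence (fun _ => K)
      · intro n; exact ((hint _).sub (hintT n)).aestronglyMeasurable
      · exact integrable_const _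
      · intro n
        refine Eventually.of_forall fun ω => ?_
        have h1 := abs_le.1 (hK ω)
        have h2 := M_nonneg (T := T) (f := f) n (T ω)
        rw [Real.norm_eq_abs, abs_le, M]
        constructor
        · have := le_max_right 0 (f ω + M T f n (T ω)); linarith
        · rw [sub_le_iff_le_add]; exact max_le (by linarith) (by linarith)
      · filter_upwards [h] with ω hω
        have hω' : T ω ∉ A := by
          intro h'
          exact hω (hinv ▸ h' : ω ∈ A)
        simp only [A, Set.mem_ofPred_eq, not_exists, not_forall, not_le] at hω'
        obtain ⟨k, hk⟩ := exists_nat_ge K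
        obtain ⟨N, hN⟩ := hω' k
        apply tendsto_const_nhds.congr'
        filter_upwards [eventually_ge_atTop N] with n hn
        have hm : Monotone fun n => M T f n (T ω) := monotone_nat_of_le_succ fun n => M_mono n _
        have := hm hn
        have h1 := abs_le.1 (hK ω)
        simp only at this
        rw [M]
        beta_reduce
        rw [max_eq_right (by linarith)]
        ring
    have : 0 ≤ ∫ ω, f ω ∂μ := by
      refine ge_of_tendsto' hlim fun n => ?_
      rw [integral_sub (hint _) (hintT n), hintTe, sub_nonneg]
      exact integral_mono (hint _) (hint _) fun ω => M_mono n ω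
    linarith

/-- empirical measure -/
noncomputable def E (T : Ω → Ω) (n : ℕ) (ω : Ω) : Measure Ω :=
  ((n : ℝ≥0∞)⁻¹) • ∑ t ∈ Finset.Icc 1 n, Measure.dirac (T^[t] ω)

lemma E_prob {n : ℕ} (hn : 1 ≤ n) (ω : Ω) : IsProbabilityMeasure (E T n ω) := by
  constructor
  simp only [E, Measure.smul_apply, Measure.finsetSum_apply, smul_eq_mul, measure_univ]
  simp
  exact ENNReal.inv_mul_cancel (by simp; omega) (by simp)

lemma E_map {X : Type*} [MeasurableSpace X] {h : Ω → X} (hh : Measurable h) (n : ℕ) (ω : Ω) :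
    (E T n ω).map h = ((n : ℝ≥0∞)⁻¹) • ∑ t ∈ Finset.Icc 1 n, Measure.dirac (h (T^[t] ω)) := by
  rw [E, Measure.map_smul, ← Measure.mapₗ_apply_of_measurable hh, map_sum]
  simp [Measure.mapₗ_apply_of_measurable hh, Measure.map_dirac' hh]

lemma E_real {S : Set Ω} (hS : MeasurableSet S) (n : ℕ) (ω : Ω) :
    (E T n ω).real S = (n : ℝ)⁻¹ * ∑ t ∈ Finset.range n, S.indicator 1 (T (T^[t] ω)) := by
  have : ∑ t ∈ Finset.Icc 1 n, (Measure.dirac (T^[t] ω) : Measure Ω) S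
     = ENNReal.ofReal (∑ t ∈ Finset.range n, S.indicator 1 (T (T^[t] ω))) := by
    induction n with
    | zero => simp
    | succ n ih =>
      rw [Finset.sum_Icc_succ_top (by omega), ih, Finset.sum_range_succ, ENNReal.ofReal_add
        (Finset.sum_nonneg fun i _ => Set.indicator_nonneg (by simp) _)
        (Set.indicator_nonneg (by simp) _), Measure.dirac_apply' _ hS,
        Function.iterate_succ_apply']
      congr 1
      by_cases h : T (T^[n] ω) ∈ S <;> simp [h]
  rw [measureReal_def, E, Measure.smul_apply, Measure.finsetSum_apply, this, smul_eq_mul,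
    ENNReal.toReal_mul, ENNReal.toReal_ofReal
      (Finset.sum_nonneg fun i _ => Set.indicator_nonneg (by simp) _)]
  simp

lemma ergodic_lower {μ : Measure Ω} [IsProbabilityMeasure μ] (hT : Ergodic T μ)
    {S : Set Ω} (hS : MeasurableSet S) {η : ℝ} (hη : 0 < η) :
    ∀ᵐ ω ∂μ, ∀ᶠ n in atTop, μ.real S - η ≤ (E T n ω).real S := by
  set f : Ω → ℝ := fun ω => (μ.real S - η / 2) - S.indicator 1 (T ω) with hf
  have hind : Measurable (S.indicator (1 : Ω → ℝ)) := measurable_one.indicator hS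
  have hfm : Measurable f := measurable_const.sub (hind.comp hT.measurable)
  have h01 : ∀ ω, 0 ≤ S.indicator (1 : Ω → ℝ) ω ∧ S.indicator (1 : Ω → ℝ) ω ≤ 1 := fun ω => by
    by_cases h : ω ∈ S <;> simp [h]
  have hK : ∀ ω, |f ω| ≤ |μ.real S - η / 2| + 1 := fun ω => by
    refine (abs_sub _ _).trans ?_
    rw [abs_of_nonneg (h01 _).1]
    linarith [(h01 (T ω)).2]
  have hi : Integrable (S.indicator (1 : Ω → ℝ)) μ := (integrable_const 1).indicator hS
  have hiT : Integrable (fun ω => S.indicator (1 : Ω → ℝ) (T ω)) μ :=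
    hT.toMeasurePreserving.integrable_comp_of_integrable hi
  have hint : ∫ ω, S.indicator (1 : Ω → ℝ) (T ω) ∂μ = μ.real S := by
    have := integral_map (μ := μ) (f := S.indicator (1 : Ω → ℝ)) hT.measurable.aemeasurable
        hind.aestronglyMeasurable
    rw [hT.toMeasurePreserving.map_eq, integral_indicator_one hS] at this
    exact this.symm
  have hneg : ∫ ω, f ω ∂μ < 0 := by
    rw [hf, integral_sub (integrable_const _) hiT, hint]
    simp
    exact hη
  filter_upwards [bdd_of_neg hT hfm hK hneg] with ω ⟨k, hk⟩
  obtain ⟨N, hN⟩ := exists_nat_ge (k / (η / 2))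
  filter_upwards [eventually_ge_atTop N, eventually_ge_atTop 1] with n hn hn1
  have h1 := (sum_le_M (T := T) (f := f) n ω).trans (hk n)
  rw [E_real hS]
  simp only [hf, Finset.sum_sub_distrib, Finset.sum_const, Finset.card_range, nsmul_eq_mul] at h1
  have hn0 : (0 : ℝ) < n := by exact_mod_cast hn1
  rw [le_inv_mul_iff₀ hn0]
  have h2 : k / (η / 2) ≤ n := hN.trans (by exact_mod_cast hn)
  rw [div_le_iff₀ (by positivity)] at h2
  nlinarith

lemma LP_map_le (P : Measure Ω) [IsProbabilityMeasure P] {f h : Ω → ℝ} (hf : Measurable f)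
    (hh : Measurable h) {ε : ℝ} (hε : 0 < ε) (G : Set Ω) (hGm : MeasurableSet G)
    (hG : ∀ ω ∈ G, |f ω - h ω| ≤ ε) (hP : 1 - ε ≤ P.real G) :
    levyProkhorovEDist (P.map f) (P.map h) ≤ ENNReal.ofReal ε := by
  have := Measure.isProbabilityMeasure_map (μ := P) hf.aemeasurable
  have := Measure.isProbabilityMeasure_map (μ := P) hh.aemeasurable
  apply levyProkhorovEDist_le_of_forall_le
  intro c B hc hc' hB
  have hεc : ε < c.toReal := (ENNReal.ofReal_lt_iff_lt_toReal hε.le hc'.ne).1 hc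
  rw [Measure.map_apply hf hB, Measure.map_apply hh Metric.isOpen_thickening.measurableSet]
  have hGc : P Gᶜ ≤ c := by
    refine le_trans ?_ hc.le
    rw [← ofReal_measureReal, probReal_compl_eq_one_sub hGm]
    exact ENNReal.ofReal_le_ofReal (by linarith)
  refine le_trans ?_ (add_le_add_right hGc _)
  refine (measure_mono ?_).trans (measure_union_le _ _)
  intro ω hω
  by_cases hg : ω ∈ G
  · left
    refine Metric.mem_thickening_iff.2 ⟨f ω, hω, ?_⟩
    rw [dist_comm, Real.dist_eq]
    exact (hG ω hg).trans_lt hεc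
  · right; exact hg

lemma LP_fixed {μ : Measure Ω} [IsProbabilityMeasure μ] (hT : Ergodic T μ)
    {f : Ω → ℝ} (hf : Measurable f) {ε : ℝ} (hε : 0 < ε) :
    ∀ᵐ ω ∂μ, ∀ᶠ n in atTop,
      levyProkhorovEDist (μ.map f) ((E T n ω).map f) ≤ ENNReal.ofReal ε := by
  obtain ⟨A, hAm, hAb, hAd, hAu, hAdisj⟩ :=
    SeparableSpace.exists_measurable_partition_diam_le (Ω := ℝ) hε
  have hFm : ∀ k, MeasurableSet (f ⁻¹' A k) := fun k => hf (hAm k)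
  have hFd : Pairwise (Function.onFun Disjoint fun k => f ⁻¹' A k) :=
    fun i j hij => (hAdisj hij).preimage f
  have hsum : HasSum (fun k => μ.real (f ⁻¹' A k)) 1 := by
    have h := measure_iUnion (μ := μ) hFd hFm
    have hu : (⋃ k, f ⁻¹' A k) = Set.univ := by rw [← Set.preimage_iUnion, hAu, Set.preimage_univ]
    rw [hu, measure_univ] at h
    have hs := ENNReal.hasSum_toReal (f := fun k => μ (f ⁻¹' A k)) (by rw [← h]; simp)
    rw [← ENNReal.tsum_toReal_eq (by simp), ← h] at hs
    simpa [measureReal_def] using hs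
  obtain ⟨N, hN⟩ := (hsum.tendsto_sum_nat.eventually
    (lt_mem_nhds (show 1 - ε / 2 < 1 by linarith))).exists
  have hη : 0 < ε / (2 * (N + 1)) := by positivity
  have hall : ∀ᵐ ω ∂μ, ∀ k, ∀ᶠ n in atTop,
      μ.real (f ⁻¹' A k) - ε / (2 * (N + 1)) ≤ (E T n ω).real (f ⁻¹' A k) :=
    ae_all_iff.2 fun k => ergodic_lower hT (hFm k) hη
  filter_upwards [hall] with ω hω
  have hω' : ∀ᶠ n in atTop, ∀ k ∈ Finset.range N, 
      μ.real (f ⁻¹' A k) - ε / (2 * (N + 1)) ≤ (E T n ω).real (f ⁻¹' A k) :=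
    (Filter.eventually_all_finset _).2 fun k _ => hω k
  filter_upwards [hω', eventually_ge_atTop 1] with n hn hn1
  have := E_prob (T := T) hn1 ω
  have := Measure.isProbabilityMeasure_map (μ := μ) hf.aemeasurable
  have := Measure.isProbabilityMeasure_map (μ := E T n ω) hf.aemeasurable
  apply levyProkhorovEDist_le_of_forall_le
  intro c B hc hc' hB
  have hεc : ε < c.toReal := (ENNReal.ofReal_lt_iff_lt_toReal hε.le hc'.ne).1 hc
  rw [Measure.map_apply hf hB, Measure.map_apply hf Metric.isOpen_thickening.measurableSet]
  classical
  set I := (Finset.range N).filter fun k => (A k ∩ B).Nonempty with hI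
  set C := ⋃ k ∈ Finset.range N, f ⁻¹' A k with hC
  have hCm : MeasurableSet C := Finset.measurableSet_biUnion _ fun k _ => hFm k
  have hCr : μ.real C = ∑ k ∈ Finset.range N, μ.real (f ⁻¹' A k) :=
    measureReal_biUnion_finset (fun i _ j _ hij => hFd hij) (fun k _ => hFm k)
  have hCc : μ.real Cᶜ ≤ ε / 2 := by rw [probReal_compl_eq_one_sub hCm, hCr]; linarith
  have h1 : μ.real (f ⁻¹' B) ≤ ∑ k ∈ I, μ.real (f ⁻¹' A k) + ε / 2 := by
    have hsub : f ⁻¹' B ⊆ (⋃ k ∈ I, f ⁻¹' A k) ∪ Cᶜ := by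
      intro x hx
      by_cases hxC : x ∈ C
      · left
        simp only [hC, Set.mem_iUnion] at hxC ⊢
        obtain ⟨k, hk, hxk⟩ := hxC
        exact ⟨k, Finset.mem_filter.2 ⟨hk, f x, hxk, hx⟩, hxk⟩
      · right; exact hxC
    calc _ ≤ μ.real ((⋃ k ∈ I, f ⁻¹' A k) ∪ Cᶜ) := measureReal_mono hsub
      _ ≤ _ := measureReal_union_le _ _
      _ ≤ _ := add_le_add (measureReal_biUnion_finset_le _ _) hCc
  have h2 : ∑ k ∈ I, μ.real (f ⁻¹' A k) ≤
      ∑ k ∈ I, ((E T n ω).real (f ⁻¹' A k) + ε / (2 * (N + 1))) :=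
    Finset.sum_le_sum fun k hk => by linarith [hn k (Finset.mem_filter.1 hk).1]
  have h3 : ∑ k ∈ I, (E T n ω).real (f ⁻¹' A k) ≤
      (E T n ω).real (f ⁻¹' Metric.thickening c.toReal B) := by
    rw [← measureReal_biUnion_finset (fun i _ j _ hij => hFd hij) (fun k _ => hFm k)]
    refine measureReal_mono ?_
    intro x hx
    simp only [Set.mem_iUnion] at hx
    obtain ⟨k, hk, hxk⟩ := hx
    obtain ⟨y, hyA, hyB⟩ := (Finset.mem_filter.1 hk).2
    refine Metric.mem_thickening_iff.2 ⟨y, hyB, ?_⟩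
    exact ((Metric.dist_le_diam_of_mem (hAb k) hxk hyA).trans (hAd k)).trans_lt hεc
  have h4 : (I.card : ℝ) * (ε / (2 * (N + 1))) ≤ ε / 2 := by
    have : (I.card : ℝ) ≤ N := by
      exact_mod_cast (Finset.card_filter_le _ _).trans (by simp)
    calc _ ≤ ((N : ℝ) + 1) * (ε / (2 * (N + 1))) := by gcongr; linarith
      _ = _ := by field_simp
  rw [Finset.sum_add_distrib, Finset.sum_const, nsmul_eq_mul] at h2
  rw [← ENNReal.toReal_le_toReal (by finiteness) (by finiteness),
    ENNReal.toReal_add (by finiteness) (by finiteness)]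
  simp only [measureReal_def] at *
  linarith

lemma exists_good {μ : Measure Ω} [IsProbabilityMeasure μ]
    {X : Type*} [PseudoMetricSpace X] [SecondCountableTopology X] {Θ : Set X}
    {g : X → Ω → ℝ} (hg : ∀ θ, Measurable (g θ))
    (hgc : ∀ ω, ContinuousOn (fun θ => g θ ω) Θ) {ε : ℝ} (hε : 0 < ε) {θ₀ : X} (h₀ : θ₀ ∈ Θ) :
    ∃ δ > 0, ∃ G : Set Ω, MeasurableSet G ∧ 1 - ε < μ.real G ∧
      ∀ ω ∈ G, ∀ θ ∈ Θ, dist θ θ₀ < δ → |g θ ω - g θ₀ ω| ≤ ε := by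
  obtain ⟨D, hDΘ, hDc, hDd⟩ := (TopologicalSpace.IsSeparable.of_separableSpace Θ).exists_countable_dense_subset
  let G : ℕ → Set Ω := fun m => ⋂ θ ∈ D ∩ Metric.ball θ₀ (1 / ((m : ℝ) + 1)),
    {ω | |g θ ω - g θ₀ ω| ≤ ε}
  have hGm : ∀ m, MeasurableSet (G m) := fun m =>
    MeasurableSet.biInter (hDc.mono Set.inter_subset_left) fun θ _ =>
      measurableSet_le ((hg θ).sub (hg θ₀)).abs measurable_const
  have hmono : Monotone G := by
    intro a b hab
    apply Set.biInter_subset_biInter_left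
    apply Set.inter_subset_inter_right
    apply Metric.ball_subset_ball
    gcongr
  have hU : ⋃ m, G m = Set.univ := by
    refine Set.eq_univ_of_forall fun ω => ?_
    obtain ⟨δ, hδ, h⟩ := Metric.continuousWithinAt_iff.1 (hgc ω θ₀ h₀) ε hε
    obtain ⟨m, hm⟩ := exists_nat_one_div_lt hδ
    refine Set.mem_iUnion.2 ⟨m, Set.mem_iInter₂.2 fun θ hθ => ?_⟩
    exact (h (hDΘ hθ.1) ((Metric.mem_ball.1 hθ.2).trans hm)).le
  have ht := tendsto_measure_iUnion_atTop (μ := μ) hmono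
  rw [hU, measure_univ] at ht
  have ht' : Tendsto (fun m => μ.real (G m)) atTop (𝓝 1) := by
    have := (ENNReal.tendsto_toReal ENNReal.one_ne_top).comp ht
    rw [ENNReal.toReal_one] at this
    exact this
  obtain ⟨m, hm⟩ := (ht'.eventually (lt_mem_nhds (show 1 - ε < 1 by linarith))).exists
  refine ⟨1 / ((m : ℝ) + 1), by positivity, G m, hGm m, hm, fun ω hω θ hθ hd => ?_⟩
  have : (𝓝[D] θ).NeBot := mem_closure_iff_nhdsWithin_neBot.1 (hDd hθ)
  have hc : Tendsto (fun θ => |g θ ω - g θ₀ ω|) (𝓝[D] θ) (𝓝 |g θ ω - g θ₀ ω|) :=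
    ((((hgc ω) θ hθ).mono hDΘ).tendsto.sub tendsto_const_nhds).abs
  refine le_of_tendsto hc ?_
  have hb : Metric.ball θ₀ (1 / ((m : ℝ) + 1)) ∈ 𝓝[D] θ :=
    mem_nhdsWithin_of_mem_nhds (Metric.isOpen_ball.mem_nhds hd)
  filter_upwards [hb, self_mem_nhdsWithin] with θ' h1 h2
  exact Set.mem_iInter₂.1 hω θ' ⟨h2, h1⟩

lemma main_eps {μ : Measure Ω} [IsProbabilityMeasure μ] (hT : Ergodic T μ)
    {X : Type*} [PseudoMetricSpace X] [SecondCountableTopology X] {Θ : Set X}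
    (hΘ : IsCompact Θ) {g : X → Ω → ℝ} (hg : ∀ θ, Measurable (g θ))
    (hgc : ∀ ω, ContinuousOn (fun θ => g θ ω) Θ) {ε : ℝ} (hε : 0 < ε) :
    ∀ᵐ ω ∂μ, ∀ᶠ n in atTop, ∀ θ ∈ Θ,
      levyProkhorovEDist ((E T n ω).map (g θ)) (μ.map (g θ)) ≤ ENNReal.ofReal (3 * ε) := by
  have H := fun θ₀ : Θ => exists_good (μ := μ) hg hgc (half_pos hε) θ₀.2
  choose δ hδ G hGm hGμ hG using H
  obtain ⟨s, hs⟩ := hΘ.elim_finite_subcover (fun θ₀ : Θ => Metric.ball (θ₀ : X) (δ θ₀))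
    (fun _ => Metric.isOpen_ball)
    (fun θ hθ => Set.mem_iUnion.2 ⟨⟨θ, hθ⟩, Metric.mem_ball_self (hδ _)⟩)
  have h1 : ∀ᵐ ω ∂μ, ∀ θ₀ ∈ s, ∀ᶠ n in atTop,
      levyProkhorovEDist (μ.map (g θ₀)) ((E T n ω).map (g θ₀)) ≤ ENNReal.ofReal ε :=
    (Filter.eventually_all_finset _).2 fun θ₀ _ => LP_fixed hT (hg θ₀) hε
  have h2 : ∀ᵐ ω ∂μ, ∀ θ₀ ∈ s, ∀ᶠ n in atTop,
      μ.real (G θ₀) - ε / 2 ≤ (E T n ω).real (G θ₀) :=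
    (Filter.eventually_all_finset _).2 fun θ₀ _ => ergodic_lower hT (hGm θ₀) (half_pos hε)
  filter_upwards [h1, h2] with ω hω1 hω2
  filter_upwards [(Filter.eventually_all_finset _).2 hω1, (Filter.eventually_all_finset _).2 hω2,
    eventually_ge_atTop 1] with n hn1 hn2 hn θ hθ
  have := E_prob (T := T) hn ω
  obtain ⟨θ₀, hθ₀, hd⟩ := Set.mem_iUnion₂.1 (hs hθ)
  have a1 : levyProkhorovEDist ((E T n ω).map (g θ)) ((E T n ω).map (g θ₀)) ≤ ENNReal.ofReal ε :=
    LP_map_le _ (hg _) (hg _) hε (G θ₀) (hGm θ₀)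
      (fun x hx => (hG θ₀ x hx θ hθ hd).trans (by linarith))
      (by linarith [hn2 θ₀ hθ₀, hGμ θ₀])
  have a2 : levyProkhorovEDist (μ.map (g θ)) (μ.map (g θ₀)) ≤ ENNReal.ofReal ε :=
    LP_map_le _ (hg _) (hg _) hε (G θ₀) (hGm θ₀)
      (fun x hx => (hG θ₀ x hx θ hθ hd).trans (by linarith))
      (by linarith [hGμ θ₀])
  have a3 := hn1 θ₀ hθ₀
  rw [levyProkhorovEDist_comm] at a2 a3
  calc _ ≤ _ := levyProkhorovEDist_triangle _ ((E T n ω).map (g θ₀)) _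
    _ ≤ _ := add_le_add_right (levyProkhorovEDist_triangle _ (μ.map (g θ₀)) _) _
    _ ≤ ENNReal.ofReal ε + (ENNReal.ofReal ε + ENNReal.ofReal ε) := by gcongr
    _ = _ := by
      rw [← ENNReal.ofReal_add hε.le hε.le, ← ENNReal.ofReal_add hε.le (by positivity)]
      congr 1; ring

end
end UGC

/-- **Uniform Glivenko–Cantelli theorem in the Lévy–Prokhorov metric for ergodic
parametric families** (point (c) of the proof of Theorem 2.3).
For an ergodic measure-preserving `T`, a compact `Θ ⊆ ℝ^d` and a jointly measurable
`g`, continuous in the parameter, the empirical distributions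
`Q_{n,θ}(ω) = (1/n) ∑_{t=1}^n δ_{g(θ, Tᵗ ω)}` converge to `Q_θ = Law(g(θ, ·))`
uniformly over `Θ` in the Lévy–Prokhorov distance, almost surely. -/
theorem uniform_glivenko_cantelli_levyProkhorov_ergodic
    {Ω : Type*} [MeasurableSpace Ω] (μ : Measure Ω) [IsProbabilityMeasure μ]
    (T : Ω → Ω) (hT : Ergodic T μ)
    (d : ℕ) (Θ : Set (Fin d → ℝ)) (hΘ : IsCompact Θ)
    (g : (Fin d → ℝ) → Ω → ℝ)
    (hgmeas : Measurable (Function.uncurry g))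
    (hgcont : ∀ ω : Ω, ContinuousOn (fun θ => g θ ω) Θ) :
    ∀ᵐ ω ∂μ, Tendsto
      (fun n : ℕ => ⨆ θ ∈ Θ, levyProkhorovEDist
        (((n : ℝ≥0∞)⁻¹) • ∑ t ∈ Finset.Icc 1 n, Measure.dirac (g θ (T^[t] ω)))
        (μ.map (g θ)))
      atTop (𝓝 0) := by
  have hg : ∀ θ, Measurable (g θ) := fun θ => hgmeas.comp measurable_prodMk_left
  have h : ∀ᵐ ω ∂μ, ∀ m : ℕ, ∀ᶠ n in atTop, ∀ θ ∈ Θ,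
      levyProkhorovEDist ((UGC.E T n ω).map (g θ)) (μ.map (g θ)) ≤
        ENNReal.ofReal (3 * (1 / ((m : ℝ) + 1))) :=
    ae_all_iff.2 fun m => UGC.main_eps hT hΘ hg hgcont (by positivity)
  filter_upwards [h] with ω hω
  rw [ENNReal.tendsto_nhds_zero]
  intro ε hε
  have hl : Tendsto (fun m : ℕ => ENNReal.ofReal (3 * (1 / ((m : ℝ) + 1)))) atTop (𝓝 0) := by
    have := ENNReal.tendsto_ofReal ((tendsto_one_div_add_atTop_nhds_zero_nat (𝕜 := ℝ)).const_mul 3)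
    simpa using this
  obtain ⟨m, hm⟩ := (hl.eventually (gt_mem_nhds hε)).exists
  filter_upwards [hω m] with n hn
  refine iSup₂_le fun θ hθ => ?_
  rw [← UGC.E_map (hg θ)]
  exact (hn θ hθ).trans hm.le
end
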